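/- arXiv:2112.02032 — 3 statements merged into one kernel-verified Lean document; each statement's English description precedes it below -/
import Mathlib

section
/- Let α > 0, σ ∈ [0,1), c > −σ, and let N ≥ 1 be an integer. Then ∫_0^1 (1 − (1−x)^N) ρ_{α,c,σ}(x) dx = α · ∑_{n=0}^{N−1} Γ(1+c)Γ(c+σ+n) / (Γ(c+σ)Γ(1+c+n)), where ρ_{α,c,σ}(x) = α · (Γ(1+c)/(Γ(1−σ)Γ(c+σ))) · x^{−1−σ}(1−x)^{c+σ−1}. -/
open MeasureTheory

theorem threeBP_aux (a b : ℝ) (ha : 0 < a) (hb : 0 < b) :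
    IntegrableOn (fun x : ℝ => x ^ (a - 1) * (1 - x) ^ (b - 1)) (Set.Ioo 0 1) ∧
    ∫ x in Set.Ioo (0 : ℝ) 1, x ^ (a - 1) * (1 - x) ^ (b - 1) =
      Real.Gamma a * Real.Gamma b / Real.Gamma (a + b) := by
  have hB := ProbabilityTheory.beta_pos ha hb
  have hnn : ∀ᵐ x ∂(volume.restrict (Set.Ioo (0 : ℝ) 1)),
      0 ≤ x ^ (a - 1) * (1 - x) ^ (b - 1) := by
    filter_upwards [ae_restrict_mem measurableSet_Ioo] with x hx
    exact mul_nonneg (Real.rpow_nonneg hx.1.le _) (Real.rpow_nonneg (by linarith [hx.2]) _)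
  have hm : Measurable (fun x : ℝ => x ^ (a - 1) * (1 - x) ^ (b - 1)) := by fun_prop
  have h1 := ProbabilityTheory.lintegral_betaPDF_eq_one ha hb
  rw [ProbabilityTheory.lintegral_betaPDF] at h1
  have h2 : ∫⁻ x in Set.Ioo (0 : ℝ) 1, ENNReal.ofReal (x ^ (a - 1) * (1 - x) ^ (b - 1))
      = ENNReal.ofReal (ProbabilityTheory.beta a b) := by
    have h3 : ∀ x : ℝ, ENNReal.ofReal (x ^ (a - 1) * (1 - x) ^ (b - 1)) =
        ENNReal.ofReal (ProbabilityTheory.beta a b) * ENNReal.ofReal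
          (1 / ProbabilityTheory.beta a b * x ^ (a - 1) * (1 - x) ^ (b - 1)) := by
      intro x
      rw [← ENNReal.ofReal_mul hB.le]
      congr 1
      field_simp
    simp_rw [h3]
    rw [lintegral_const_mul _ (by fun_prop), h1, mul_one]
  constructor
  · refine ⟨hm.aestronglyMeasurable, ?_⟩
    rw [hasFiniteIntegral_iff_ofReal hnn, h2]
    exact ENNReal.ofReal_lt_top
  · rw [integral_eq_lintegral_of_nonneg_ae hnn hm.aestronglyMeasurable, h2,
      ENNReal.toReal_ofReal hB.le]
    rfl

/-- The Lévy rate density of the three-parameter beta process `3BP(α, c, σ)`. -/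
noncomputable def threeBPDensity (α c σ : ℝ) (x : ℝ) : ℝ :=
  α * (Real.Gamma (1 + c) / (Real.Gamma (1 - σ) * Real.Gamma (c + σ))) *
    x ^ (-1 - σ) * (1 - x) ^ (c + σ - 1)

/-- **Expected number of distinct variants in `N` samples.**
For `α > 0`, `σ ∈ [0,1)`, `c > −σ`, and `N ≥ 1`,
`∫_0^1 (1 − (1−x)^N) ρ_{α,c,σ}(x) dx = α ∑_{n=0}^{N−1} Γ(1+c)Γ(c+σ+n)/(Γ(c+σ)Γ(1+c+n))`. -/
theorem threeBP_expected_distinct_variants (α c σ : ℝ) (hα : 0 < α)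
    (hσ0 : 0 ≤ σ) (hσ1 : σ < 1) (hc : -σ < c) (N : ℕ) (hN : 1 ≤ N) :
    ∫ x in Set.Ioo (0 : ℝ) 1, (1 - (1 - x) ^ N) * threeBPDensity α c σ x =
      α * ∑ n ∈ Finset.range N,
        Real.Gamma (1 + c) * Real.Gamma (c + σ + n) /
          (Real.Gamma (c + σ) * Real.Gamma (1 + c + n)) := by
  have hg1 : Real.Gamma (1 - σ) ≠ 0 := (Real.Gamma_pos_of_pos (by linarith)).ne'
  have hg2 : Real.Gamma (c + σ) ≠ 0 := (Real.Gamma_pos_of_pos (by linarith)).ne'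
  have hb : ∀ n : ℕ, 0 < c + σ + n := fun n => by
    have : (0 : ℝ) ≤ n := n.cast_nonneg
    linarith
  have key : ∀ x ∈ Set.Ioo (0 : ℝ) 1, (1 - (1 - x) ^ N) * threeBPDensity α c σ x =
      ∑ n ∈ Finset.range N,
        α * (Real.Gamma (1 + c) / (Real.Gamma (1 - σ) * Real.Gamma (c + σ))) *
        (x ^ ((1 - σ) - 1) * (1 - x) ^ ((c + σ + n) - 1)) := by
    intro x hx
    have hx0 : 0 < x := hx.1
    have hx1 : 0 < 1 - x := by linarith [hx.2]
    have e1 : x ^ ((1 - σ) - 1) = x * x ^ (-1 - σ) := by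
      rw [show (1 - σ) - 1 = 1 + (-1 - σ) by ring, Real.rpow_add hx0, Real.rpow_one]
    have e2 : ∀ n : ℕ, (1 - x) ^ ((c + σ + n) - 1) = (1 - x) ^ n * (1 - x) ^ (c + σ - 1) := by
      intro n
      rw [show c + σ + n - 1 = n + (c + σ - 1) by ring, Real.rpow_add hx1, Real.rpow_natCast]
    have e3 := mul_neg_geom_sum (1 - x) N
    simp_rw [e1, e2, threeBPDensity]
    rw [← e3, ← Finset.mul_sum, ← Finset.mul_sum, ← Finset.sum_mul]
    ring
  rw [setIntegral_congr_fun measurableSet_Ioo key, integral_finsetSum, Finset.mul_sum]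
  · refine Finset.sum_congr rfl fun n _ => ?_
    rw [integral_const_mul, (threeBP_aux (1 - σ) (c + σ + n) (by linarith) (hb n)).2,
      show 1 - σ + (c + σ + n) = 1 + c + n by ring]
    field_simp
  · intro n _
    exact ((threeBP_aux (1 - σ) (c + σ + n) (by linarith) (hb n)).1).const_mul _
end

section
/- Let α > 0, σ ∈ [0,1), c > −σ, let N ≥ 0 and M ≥ 1 and k be integers with 1 ≤ k ≤ M, and let φ_pilot, φ_follow ∈ (0,1]. Then ∫_0^1 (M choose k)(φ_follow x)^k (1 − φ_follow x)^{M−k} (1 − φ_pilot x)^N ρ_{α,c,σ}(x) dx = α (M choose k) φ_follow^k · (Γ(1+c)Γ(k−σ) / (Γ(1−σ)Γ(k+c))) · ∫_0^1 (1 − φ_follow y)^{M−k} (1 − φ_pilot y)^N β_{k−σ, c+σ}(y) dy, where ρ_{α,c,σ}(x) = α·(Γ(1+c)/(Γ(1−σ)Γ(c+σ)))·x^{−1−σ}(1−x)^{c+σ−1} and β_{a,b}(y) = y^{a−1}(1−y)^{b−1}·Γ(a+b)/(Γ(a)Γ(b)) is the Beta(a,b) probability density. -/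
open MeasureTheory

/-- The `Beta(a,b)` probability density on `(0,1)`:
`β_{a,b}(y) = y^{a−1}(1−y)^{b−1} Γ(a+b)/(Γ(a)Γ(b))`. -/
noncomputable def betaDensity (a b : ℝ) (y : ℝ) : ℝ :=
  y ^ (a - 1) * (1 - y) ^ (b - 1) * Real.Gamma (a + b) / (Real.Gamma a * Real.Gamma b)

/-- **Poisson mean `γ_k` of the posterior predictive number of `k`-tons
with sequencing error, as a Beta expectation.**
For `α > 0`, `σ ∈ [0,1)`, `c > −σ`, integers `N ≥ 0`, `M ≥ 1`, `1 ≤ k ≤ M`, and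
detection probabilities `φ_pilot, φ_follow ∈ (0,1]`,
`∫_0^1 (M choose k)(φ_f x)^k (1−φ_f x)^{M−k} (1−φ_p x)^N ρ_{α,c,σ}(x) dx
  = α (M choose k) φ_f^k (Γ(1+c)Γ(k−σ)/(Γ(1−σ)Γ(k+c)))
      ∫_0^1 (1−φ_f y)^{M−k} (1−φ_p y)^N β_{k−σ,c+σ}(y) dy`. -/
theorem threeBP_gamma_k_as_beta_expectation (α c σ : ℝ) (hα : 0 < α)
    (hσ0 : 0 ≤ σ) (hσ1 : σ < 1) (hc : -σ < c) (N M k : ℕ) (hM : 1 ≤ M)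
    (hk : 1 ≤ k) (hkM : k ≤ M) (φp φf : ℝ)
    (hφp0 : 0 < φp) (hφp1 : φp ≤ 1) (hφf0 : 0 < φf) (hφf1 : φf ≤ 1) :
    ∫ x in Set.Ioo (0 : ℝ) 1,
        (M.choose k : ℝ) * (φf * x) ^ k * (1 - φf * x) ^ (M - k) * (1 - φp * x) ^ N *
          threeBPDensity α c σ x =
      α * (M.choose k : ℝ) * φf ^ k *
        (Real.Gamma (1 + c) * Real.Gamma (k - σ) /
          (Real.Gamma (1 - σ) * Real.Gamma (k + c))) *
        ∫ y in Set.Ioo (0 : ℝ) 1,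
          (1 - φf * y) ^ (M - k) * (1 - φp * y) ^ N * betaDensity (k - σ) (c + σ) y := by
  have hk1 : (1 : ℝ) ≤ k := by exact_mod_cast hk
  have h1 : Real.Gamma (k - σ) ≠ 0 := (Real.Gamma_pos_of_pos (by linarith)).ne'
  have h2 : Real.Gamma (k + c) ≠ 0 := (Real.Gamma_pos_of_pos (by linarith)).ne'
  have h3 : Real.Gamma (1 - σ) ≠ 0 := (Real.Gamma_pos_of_pos (by linarith)).ne'
  have h4 : Real.Gamma (c + σ) ≠ 0 := (Real.Gamma_pos_of_pos (by linarith)).ne'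
  rw [← integral_const_mul]
  refine setIntegral_congr_fun measurableSet_Ioo fun x hx => ?_
  have e : x ^ ((k : ℝ) - σ - 1) = x ^ k * x ^ (-1 - σ) := by
    rw [← Real.rpow_natCast, ← Real.rpow_add hx.1]
    congr 1
    ring
  have e2 : (k : ℝ) - σ + (c + σ) = k + c := by ring
  simp only [threeBPDensity, betaDensity]
  rw [e, e2, mul_pow]
  generalize (1 - x) ^ (c + σ - 1) = A
  generalize x ^ (-1 - σ) = B
  generalize (1 - φf * x) ^ (M - k) = C
  generalize (1 - φp * x) ^ N = E
  generalize Real.Gamma (k - σ) = g1 at *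
  generalize Real.Gamma (k + c) = g2 at *
  generalize Real.Gamma (1 - σ) = g3 at *
  generalize Real.Gamma (c + σ) = g4 at *
  field_simp
end

section
/- Let α > 0, σ ∈ [0,1), c > −σ, and let N ≥ 0 and M ≥ 1 be integers. Then ∫_0^1 (1−x)^N (1 − (1−x)^M) ρ_{α,c,σ}(x) dx = α · ∑_{n=N}^{N+M−1} Γ(1+c)Γ(c+σ+n) / (Γ(c+σ)Γ(1+c+n)), where ρ_{α,c,σ}(x) = α · (Γ(1+c)/(Γ(1−σ)Γ(c+σ))) · x^{−1−σ}(1−x)^{c+σ−1}. -/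
open MeasureTheory

open Set in
lemma beta_aux {a b : ℝ} (ha : 0 < a) (hb : 0 < b) :
    IntegrableOn (fun x : ℝ => x ^ (a - 1) * (1 - x) ^ (b - 1)) (Ioo 0 1) ∧
    ∫ x in Ioo (0 : ℝ) 1, x ^ (a - 1) * (1 - x) ^ (b - 1) =
      Real.Gamma a * Real.Gamma b / Real.Gamma (a + b) := by
  have hcast : ∀ x ∈ Ioc (0 : ℝ) 1, (x : ℂ) ^ ((a : ℂ) - 1) * (1 - (x : ℂ)) ^ ((b : ℂ) - 1)
      = ((x ^ (a - 1) * (1 - x) ^ (b - 1) : ℝ) : ℂ) := by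
    intro x hx
    rw [Complex.ofReal_mul, Complex.ofReal_cpow hx.1.le, Complex.ofReal_cpow (by linarith [hx.2])]
    push_cast
    rfl
  have hconv := Complex.betaIntegral_convergent (u := a) (v := b) (by simpa) (by simpa)
  rw [intervalIntegrable_iff_integrableOn_Ioc_of_le zero_le_one] at hconv
  have h1 := (integrableOn_congr_fun hcast measurableSet_Ioc).1 hconv
  have h2 : IntegrableOn (fun x : ℝ => x ^ (a - 1) * (1 - x) ^ (b - 1)) (Ioc 0 1) := by
    have := h1.re
    simpa [IntegrableOn] using this
  refine ⟨h2.mono_set Ioo_subset_Ioc_self, ?_⟩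
  have h3 := Complex.betaIntegral_eq_Gamma_mul_div a b (by simpa) (by simpa)
  rw [Complex.betaIntegral, intervalIntegral.integral_of_le zero_le_one,
    setIntegral_congr_fun measurableSet_Ioc hcast, integral_complex_ofReal,
    ← Complex.ofReal_add, Complex.Gamma_ofReal, Complex.Gamma_ofReal, Complex.Gamma_ofReal] at h3
  rw [← integral_Ioc_eq_integral_Ioo]
  exact_mod_cast h3

/-- **Expected number of new distinct variants in `M` additional samples after `N`.**
For `α > 0`, `σ ∈ [0,1)`, `c > −σ`, integers `N ≥ 0` and `M ≥ 1`,
`∫_0^1 (1−x)^N (1 − (1−x)^M) ρ_{α,c,σ}(x) dx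
  = α ∑_{n=N}^{N+M−1} Γ(1+c)Γ(c+σ+n)/(Γ(c+σ)Γ(1+c+n))`. -/
theorem threeBP_expected_new_variants (α c σ : ℝ) (hα : 0 < α)
    (hσ0 : 0 ≤ σ) (hσ1 : σ < 1) (hc : -σ < c) (N M : ℕ) (hM : 1 ≤ M) :
    ∫ x in Set.Ioo (0 : ℝ) 1,
        (1 - x) ^ N * (1 - (1 - x) ^ M) * threeBPDensity α c σ x =
      α * ∑ n ∈ Finset.Ico N (N + M),
        Real.Gamma (1 + c) * Real.Gamma (c + σ + n) /
          (Real.Gamma (c + σ) * Real.Gamma (1 + c + n)) := by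
  have key : ∀ k : ℕ, 0 < c + σ + (N + k : ℕ) := fun k => by
    have : (0 : ℝ) ≤ (N + k : ℕ) := Nat.cast_nonneg _
    linarith
  have hs : 0 < 1 - σ := by linarith
  set K := α * (Real.Gamma (1 + c) / (Real.Gamma (1 - σ) * Real.Gamma (c + σ))) with hK
  have hpt : ∀ x ∈ Set.Ioo (0 : ℝ) 1,
      (1 - x) ^ N * (1 - (1 - x) ^ M) * threeBPDensity α c σ x =
      ∑ k ∈ Finset.range M,
        K * (x ^ ((1 - σ) - 1) * (1 - x) ^ (c + σ + (N + k : ℕ) - 1)) := by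
    intro x hx
    have hx0 : 0 < x := hx.1
    have hx1 : 0 < 1 - x := by linarith [hx.2]
    have e1 : x ^ ((1 - σ) - 1) = x * x ^ (-1 - σ) := by
      rw [show (1 - σ) - 1 = (-1 - σ) + 1 by ring, Real.rpow_add_one hx0.ne']
      ring
    have e2 : ∀ k : ℕ, (1 - x) ^ (c + σ + (N + k : ℕ) - 1) =
        (1 - x) ^ (c + σ - 1) * ((1 - x) ^ N * (1 - x) ^ k) := by
      intro k
      rw [show c + σ + (N + k : ℕ) - 1 = (c + σ - 1) + (N + k : ℕ) by ring,
        Real.rpow_add_natCast hx1.ne', pow_add]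
    have e3 : 1 - (1 - x) ^ M = x * ∑ k ∈ Finset.range M, (1 - x) ^ k := by
      have := mul_neg_geom_sum (1 - x) M
      rw [← this]
      ring
    simp_rw [e1, e2]
    rw [e3, threeBPDensity, ← hK, Finset.mul_sum, Finset.mul_sum, Finset.sum_mul]
    refine Finset.sum_congr rfl fun k _ => ?_
    ring
  rw [setIntegral_congr_fun measurableSet_Ioo hpt,
    integral_finsetSum _ fun k _ => ((beta_aux hs (key k)).1.const_mul K),
    Finset.sum_Ico_eq_sum_range, Finset.mul_sum, Nat.add_sub_cancel_left]
  refine Finset.sum_congr rfl fun k _ => ?_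
  rw [integral_const_mul, (beta_aux hs (key k)).2,
    show 1 - σ + (c + σ + (N + k : ℕ)) = 1 + c + (N + k : ℕ) by ring, hK]
  have g := (Real.Gamma_pos_of_pos hs).ne'
  field_simp
end
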